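/- arXiv:2108.06469 — 6 statements merged into one kernel-verified Lean document; each statement's English description precedes it below -/
import Mathlib

section
/- Let k > 0 and n ∈ ℕ₀ (the nonnegative integers). Define d₀ := inf over m ∈ ℤ of |k² − m·π²|. Set μ̃ := (n + 1/2)·π if d₀ ≤ π²/8, and μ̃ := n·π otherwise. Let t := √|k² − μ̃²|. Then for every integer j, |t − j·π| ≥ (π/8) / (1 + 2t/π). -/
open scoped Real

/-- If `s²` is at distance at least `1/8` from every integer, then `s ≥ 0` is quantitatively
away from the integers. -/
lemma one_eighth_le_abs_sub_mul {s : ℝ} (hs : 0 ≤ s)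
    (h : ∀ m : ℤ, 1 / 8 ≤ |s ^ 2 - m|) (j : ℤ) : 1 / 8 ≤ |s - j| * (1 + 2 * s) := by
  by_cases hfar : 1 ≤ |s - j|
  · nlinarith
  push Not at hfar
  obtain ⟨h1, h2⟩ := abs_lt.mp hfar
  have hj : (0 : ℝ) ≤ j := by
    have : (-1 : ℤ) < j := by
      have : ((-1 : ℤ) : ℝ) < j := by push_cast; linarith
      exact_mod_cast this
    exact_mod_cast (show (0 : ℤ) ≤ j by lia)
  have h3 := h (j ^ 2)
  have h4 : s ^ 2 - ((j ^ 2 : ℤ) : ℝ) = (s - j) * (s + j) := by push_cast; ring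
  rw [h4, abs_mul, abs_of_nonneg (by linarith : 0 ≤ s + j)] at h3
  exact h3.trans (mul_le_mul_of_nonneg_left (by linarith) (abs_nonneg _))

/-- If the distance from `x` to `ℤ` is at most `1/8`, then `x - 1/4` has distance at least `1/8`
from every integer. -/
lemma one_eighth_le_abs_sub_quarter_sub {x : ℝ} (hx : (⨅ m : ℤ, |x - m|) ≤ 1 / 8) (m : ℤ) :
    1 / 8 ≤ |x - 1 / 4 - m| := by
  by_contra! hlt
  obtain ⟨i, hi⟩ := exists_lt_of_ciInf_lt
    (show (⨅ m : ℤ, |x - m|) < 1 / 4 - |x - 1 / 4 - m| by linarith)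
  obtain ⟨h1, h2⟩ := abs_lt.mp hi
  have h3 := le_abs_self (x - 1 / 4 - m)
  have h4 := neg_abs_le (x - 1 / 4 - m)
  have h5 : m < i := by
    have : (m : ℝ) < i := by linarith
    exact_mod_cast this
  have h6 : i < m + 1 := by
    have : (i : ℝ) < ((m + 1 : ℤ) : ℝ) := by push_cast; linarith
    exact_mod_cast this
  lia

/-- The scaled difference `x - ν²` is at distance at least `1/8` from `ℤ`, where `ν` is a
half-integer if `x` is within `1/8` of `ℤ`, and an integer otherwise. -/
lemma one_eighth_le_abs_sub_sq_sub (x : ℝ) (n : ℕ) (m : ℤ) :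
    1 / 8 ≤ |x - (if (⨅ m : ℤ, |x - m|) ≤ 1 / 8 then (n : ℝ) + 1 / 2 else n) ^ 2 - m| := by
  split_ifs with h
  · convert one_eighth_le_abs_sub_quarter_sub h (n ^ 2 + n + m) using 2
    push_cast
    ring
  · push Not at h
    have hbdd : BddBelow (Set.range fun m : ℤ => |x - m|) :=
      ⟨0, by rintro _ ⟨i, rfl⟩; positivity⟩
    have h1 : (x - n ^ 2 - m : ℝ) = x - ((n ^ 2 + m : ℤ) : ℝ) := by push_cast; ring
    rw [h1]
    exact h.le.trans (ciInf_le hbdd (n ^ 2 + m))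

/-- Case `B₁ = B₃` of the grid-choice lemma: with the wavenumber-dependent choice of
horizontal eigenvalue, the vertical frequency `t = √|k² − μ̃²|` stays quantitatively
away from `πℤ`. -/
theorem stmt_6 (k : ℝ) (hk : 0 < k) (n : ℕ)
    (d0 : ℝ) (hd0 : d0 = ⨅ m : ℤ, |k ^ 2 - (m : ℝ) * π ^ 2|)
    (μ : ℝ)
    (hμ : μ = if d0 ≤ π ^ 2 / 8 then ((n : ℝ) + 1 / 2) * π else (n : ℝ) * π)
    (t : ℝ) (ht : t = Real.sqrt |k ^ 2 - μ ^ 2|) :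
    ∀ j : ℤ, |t - (j : ℝ) * π| ≥ (π / 8) / (1 + 2 * t / π) := by
  intro j
  have hπ := Real.pi_pos
  set x : ℝ := k ^ 2 / π ^ 2 with hx
  set ν : ℝ := if (⨅ m : ℤ, |x - m|) ≤ 1 / 8 then (n : ℝ) + 1 / 2 else n with hν
  have hkx : k ^ 2 = x * π ^ 2 := by rw [hx]; field_simp
  have hd : d0 = (⨅ m : ℤ, |x - m|) * π ^ 2 := by
    rw [hd0, Real.iInf_mul_of_nonneg (by positivity)]
    refine iInf_congr fun m => ?_
    rw [hkx, ← sub_mul, abs_mul, abs_of_pos (by positivity : 0 < π ^ 2)]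
  have hiff : d0 ≤ π ^ 2 / 8 ↔ (⨅ m : ℤ, |x - m|) ≤ 1 / 8 := by
    rw [hd, show π ^ 2 / 8 = 1 / 8 * π ^ 2 by ring]
    exact mul_le_mul_iff_of_pos_right (by positivity)
  have hμν : μ = ν * π := by
    simp only [hμ, hν, hiff, ite_mul]
  have ht0 : 0 ≤ t := ht ▸ Real.sqrt_nonneg _
  have hs2 : (t / π) ^ 2 = |x - ν ^ 2| := by
    rw [div_pow, ht, Real.sq_sqrt (abs_nonneg _), hμν, hkx, mul_pow, ← sub_mul, abs_mul,
      abs_of_pos (by positivity : 0 < π ^ 2)]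
    field_simp
  have hs : ∀ m : ℤ, 1 / 8 ≤ |(t / π) ^ 2 - m| := by
    intro m
    rw [hs2]
    rcases abs_choice (x - ν ^ 2) with h | h <;> rw [h]
    · exact one_eighth_le_abs_sub_sq_sub x n m
    · have h1 := one_eighth_le_abs_sub_sq_sub x n (-m)
      rw [← abs_neg] at h1
      convert h1 using 2
      push_cast
      ring
  have key := one_eighth_le_abs_sub_mul (by positivity) hs j
  have hfac : |t - j * π| = |t / π - j| * π := by
    rw [← abs_of_pos hπ, ← abs_mul, abs_of_pos hπ]
    congr 1
    field_simp
  rw [ge_iff_le, div_le_iff₀ (by positivity), hfac, mul_div_assoc]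
  nlinarith
end

section
/- Let k > 0 and n ∈ ℕ₀ (the nonnegative integers). Define d₀ := inf over m ∈ ℤ of |k² − m·π²|. Set μ̃ := n·π if d₀ ∈ [0, π²/8] ∪ [3π²/8, π²/2], and μ̃ := (n + 1/2)·π otherwise. Let t := √|k² − μ̃²|. Then for every integer j, |t − (j + 1/2)·π| ≥ (π/8) / (1 + 2t/π). -/
open scoped Real

theorem abs_sub_ge_of_abs_sq_sub_sq_ge {s a : ℝ} (hs : 0 ≤ s) (h : 1 / 8 ≤ |s ^ 2 - a ^ 2|) :
    (1 / 8) / (1 + 2 * s) ≤ |s - a| := by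
  rw [div_le_iff₀ (by linarith)]
  rcases le_or_gt (1 / 8) |s - a| with hc | hc
  · nlinarith [mul_nonneg (abs_nonneg (s - a)) hs]
  · have hsum : |s + a| ≤ 1 + 2 * s := by
      obtain ⟨h1, h2⟩ := abs_lt.mp hc
      exact abs_le.mpr ⟨by linarith, by linarith⟩
    calc 1 / 8 ≤ |s ^ 2 - a ^ 2| := h
      _ = |s - a| * |s + a| := by rw [← abs_mul]; ring_nf
      _ ≤ |s - a| * (1 + 2 * s) := by gcongr

theorem int_cast_trichotomy (M : ℤ) : (M : ℝ) ≤ -1 ∨ (M : ℝ) = 0 ∨ 1 ≤ (M : ℝ) := by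
  have : M ≤ -1 ∨ M = 0 ∨ 1 ≤ M := by omega
  exact_mod_cast this

theorem eighth_le_abs_add_int_sub_quarter {e : ℝ} (he : |e| ≤ 1 / 2)
    (h : |e| ≤ 1 / 8 ∨ 3 / 8 ≤ |e|) (M : ℤ) : 1 / 8 ≤ |e + M - 1 / 4| := by
  rw [abs_le] at he h
  rw [le_abs] at h ⊢
  rcases int_cast_trichotomy M with hM | hM | hM
  · right; linarith
  · rcases h with h | h | h
    · right; linarith
    · left; linarith
    · right; linarith
  · left; linarith

theorem eighth_le_abs_add_int {e : ℝ} (h1 : 1 / 8 ≤ |e|) (h2 : |e| ≤ 3 / 8) (M : ℤ) :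
    1 / 8 ≤ |e + M| := by
  rw [abs_le] at h2
  rw [le_abs] at h1 ⊢
  rcases int_cast_trichotomy M with hM | hM | hM
  · right; linarith
  · rw [hM, add_zero]; exact h1
  · left; linarith

theorem eighth_le_abs_add_int_sub_half {e : ℝ} (h2 : |e| ≤ 3 / 8) (M : ℤ) :
    1 / 8 ≤ |e + M - 1 / 2| := by
  rw [abs_le] at h2
  rw [le_abs]
  rcases int_cast_trichotomy M with hM | hM | hM
  · right; linarith
  · right; linarith
  · left; linarith

theorem iInf_abs_sub_int_mul {c : ℝ} (hc : 0 < c) (x : ℝ) :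
    ⨅ m : ℤ, |x * c - m * c| = |x - round x| * c := by
  have key (m : ℤ) : |x * c - m * c| = |x - m| * c := by
    rw [← sub_mul, abs_mul, abs_of_pos hc]
  apply le_antisymm
  · rw [← key]
    exact ciInf_le ⟨0, by rintro _ ⟨m, rfl⟩; exact abs_nonneg _⟩ (round x)
  · refine le_ciInf fun m => ?_
    rw [key]
    exact mul_le_mul_of_nonneg_right (round_le x m) hc.le

/-- Case `B₁ ≠ B₃` of the grid-choice lemma: with the wavenumber-dependent choice of
horizontal eigenvalue, the vertical frequency `t = √|k² − μ̃²|` stays quantitatively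
away from `π(ℤ + 1/2)`. -/
theorem stmt_7 (k : ℝ) (hk : 0 < k) (n : ℕ)
    (d0 : ℝ) (hd0 : d0 = ⨅ m : ℤ, |k ^ 2 - (m : ℝ) * π ^ 2|)
    (μ : ℝ)
    (hμ : μ = if (0 ≤ d0 ∧ d0 ≤ π ^ 2 / 8) ∨ (3 * π ^ 2 / 8 ≤ d0 ∧ d0 ≤ π ^ 2 / 2)
      then (n : ℝ) * π else ((n : ℝ) + 1 / 2) * π)
    (t : ℝ) (ht : t = Real.sqrt |k ^ 2 - μ ^ 2|) :
    ∀ j : ℤ, |t - ((j : ℝ) + 1 / 2) * π| ≥ (π / 8) / (1 + 2 * t / π) := by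
  intro j
  have hπ : 0 < π := Real.pi_pos
  have hπ2 : 0 < π ^ 2 := by positivity
  obtain ⟨x, hx⟩ : ∃ x, k ^ 2 = x * π ^ 2 := ⟨k ^ 2 / π ^ 2, by field_simp⟩
  obtain ⟨ν, hν⟩ : ∃ ν, μ = ν * π := ⟨μ / π, by field_simp⟩
  obtain ⟨s, hs⟩ : ∃ s, t = s * π := ⟨t / π, by field_simp⟩
  have hs0 : 0 ≤ s := by
    have : 0 ≤ s * π := by rw [← hs, ht]; exact Real.sqrt_nonneg _
    exact nonneg_of_mul_nonneg_left this hπ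
  have hs2 : s ^ 2 = |x - ν ^ 2| := by
    have h : t ^ 2 = |k ^ 2 - μ ^ 2| := by rw [ht, Real.sq_sqrt (abs_nonneg _)]
    rw [hs, hx, hν, mul_pow, mul_pow, ← sub_mul, abs_mul, abs_of_pos hπ2] at h
    exact mul_right_cancel₀ hπ2.ne' h
  rw [hx, iInf_abs_sub_int_mul hπ2] at hd0
  have he := abs_sub_round x
  obtain ⟨e, hxe⟩ : ∃ e, e = x - round x := ⟨_, rfl⟩
  rw [← hxe] at hd0 he
  have hxe' : x = e + round x := by linarith
  have main : 1 / 8 ≤ |s ^ 2 - ((j : ℝ) + 1 / 2) ^ 2| := by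
    rw [hs2]
    split_ifs at hμ with hc
    · have hνn : ν = n := mul_right_cancel₀ hπ.ne' (hν.symm.trans hμ)
      have hd : |e| ≤ 1 / 8 ∨ 3 / 8 ≤ |e| := by
        rw [hd0] at hc
        rcases hc with hc | hc
        · left; nlinarith [hc.2]
        · right; nlinarith [hc.1]
      rcases abs_choice (x - ν ^ 2) with hsg | hsg
      · convert eighth_le_abs_add_int_sub_quarter he hd (round x - n ^ 2 - j ^ 2 - j) using 2
        rw [hsg, hνn]; push_cast; linear_combination hxe'
      · convert eighth_le_abs_add_int_sub_quarter (e := -e) (by rwa [abs_neg])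
          (by rwa [abs_neg]) (-round x + n ^ 2 - j ^ 2 - j) using 2
        rw [hsg, hνn]; push_cast; linear_combination -hxe'
    · have hνn : ν = n + 1 / 2 := mul_right_cancel₀ hπ.ne' (hν.symm.trans hμ)
      push Not at hc
      have hlo : 1 / 8 ≤ |e| := by
        have := hc.1 (by rw [hd0]; positivity)
        nlinarith
      have hhi : |e| ≤ 3 / 8 := by
        by_contra! h
        have := hc.2 (by nlinarith)
        nlinarith
      rcases abs_choice (x - ν ^ 2) with hsg | hsg
      · convert eighth_le_abs_add_int_sub_half hhi
          (round x - n ^ 2 - n - j ^ 2 - j) using 2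
        rw [hsg, hνn]; push_cast; linear_combination hxe'
      · convert eighth_le_abs_add_int (e := -e) (by rwa [abs_neg]) (by rwa [abs_neg])
          (-round x + n ^ 2 + n - j ^ 2 - j) using 2
        rw [hsg, hνn]; push_cast; linear_combination -hxe'
  have h := mul_le_mul_of_nonneg_right (abs_sub_ge_of_abs_sq_sub_sq_ge hs0 main) hπ.le
  have hst : 2 * t / π = 2 * s := by rw [hs]; field_simp
  have habs : |t - ((j : ℝ) + 1 / 2) * π| = |s - ((j : ℝ) + 1 / 2)| * π := by
    rw [hs, ← sub_mul, abs_mul, abs_of_pos hπ]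
  rw [ge_iff_le, hst, habs]
  calc π / 8 / (1 + 2 * s) = 1 / 8 / (1 + 2 * s) * π := by ring
    _ ≤ |s - ((j : ℝ) + 1 / 2)| * π := h
end

section
/- Let k > 0 and let μ belong to the set M := {nπ : n ∈ ℕ₀} ∪ {(n + 1/2)π : n ∈ ℕ₀}. (i) If μ < k, then with λ := √(1 − μ²/k²), [(1 + λ²) − (sin(2kλ)/(2kλ))·(1 − λ²)²] / [(1 + λ²)² − cos²(kλ)·(1 − λ²)²] ≤ max{k², 1}. (ii) If μ > k, then with λ := √(μ²/k² − 1), [2(λ² + 1)²·(sinh(2kλ)/(2kλ)) + 2(λ² − 1)] / [(λ² + 1)²·(cosh(2kλ) − 1) + 8λ²] ≤ 3. -/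
open scoped Real

theorem Real.sinh_le_mul_cosh {x : ℝ} (hx : 0 ≤ x) : Real.sinh x ≤ x * Real.cosh x := by
  have hd : ∀ y : ℝ, HasDerivAt (fun z => z * Real.cosh z - Real.sinh z) (y * Real.sinh y) y := by
    intro y
    refine (((hasDerivAt_id' y).mul (Real.hasDerivAt_cosh y)).sub
      (Real.hasDerivAt_sinh y)).congr_deriv ?_
    ring
  have hmono : MonotoneOn (fun z => z * Real.cosh z - Real.sinh z) (Set.Ici 0) := by
    refine monotoneOn_of_deriv_nonneg (convex_Ici 0)
      (fun y _ => (hd y).continuousAt.continuousWithinAt)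
      (fun y _ => (hd y).differentiableAt.differentiableWithinAt) ?_
    intro y hy
    rw [interior_Ici, Set.mem_Ioi] at hy
    rw [(hd y).deriv]
    exact mul_nonneg hy.le (Real.sinh_nonneg_iff.2 hy.le)
  have h := hmono (Set.mem_Ici.2 le_rfl) (Set.mem_Ici.2 hx) hx
  simpa using h

theorem Real.one_add_sq_div_two_le_cosh {x : ℝ} (hx : 0 ≤ x) : 1 + x ^ 2 / 2 ≤ Real.cosh x := by
  have h1 : x / 2 ≤ Real.sinh (x / 2) := Real.self_le_sinh_iff.2 (by positivity)
  have h2 : Real.cosh x = 1 + 2 * Real.sinh (x / 2) ^ 2 := by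
    have h := Real.cosh_two_mul (x / 2)
    rw [mul_div_cancel₀ x two_ne_zero, Real.cosh_sq] at h
    linarith
  nlinarith [mul_self_le_mul_self (by positivity : (0 : ℝ) ≤ x / 2) h1]

/-- Per-mode bounds `φₙ ≤ max{k²,1}` (propagating) and `ψₙ ≤ 3` (evanescent) for the
impedance–impedance boundary configuration. -/
theorem stmt_8 (k μ : ℝ) (hk : 0 < k)
    (hμ : ∃ n : ℕ, μ = (n : ℝ) * π ∨ μ = ((n : ℝ) + 1 / 2) * π) :
    (∀ l : ℝ, μ < k → l = Real.sqrt (1 - μ ^ 2 / k ^ 2) →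
      ((1 + l ^ 2) - (Real.sin (2 * k * l) / (2 * k * l)) * (1 - l ^ 2) ^ 2)
        / ((1 + l ^ 2) ^ 2 - Real.cos (k * l) ^ 2 * (1 - l ^ 2) ^ 2)
      ≤ max (k ^ 2) 1)
    ∧ (∀ l : ℝ, k < μ → l = Real.sqrt (μ ^ 2 / k ^ 2 - 1) →
      (2 * (l ^ 2 + 1) ^ 2 * (Real.sinh (2 * k * l) / (2 * k * l)) + 2 * (l ^ 2 - 1))
        / ((l ^ 2 + 1) ^ 2 * (Real.cosh (2 * k * l) - 1) + 8 * l ^ 2)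
      ≤ 3) := by
  have hμ0 : μ = 0 ∨ 3 / 2 ≤ μ := by
    obtain ⟨n, rfl | rfl⟩ := hμ
    · rcases Nat.eq_zero_or_pos n with rfl | hn
      · simp
      · right
        have hn' : (1 : ℝ) ≤ n := by exact_mod_cast hn
        nlinarith [Real.pi_gt_three]
    · right
      have hn' : (0 : ℝ) ≤ n := n.cast_nonneg
      nlinarith [Real.pi_gt_three]
  have hk2 : 0 < k ^ 2 := by positivity
  refine ⟨?_, ?_⟩
  · rintro l hμk hl
    rcases hμ0 with rfl | hμ1
    · have hl1 : l = 1 := by simp [hl]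
      subst hl1
      have := le_max_right (k ^ 2) (1 : ℝ)
      norm_num
    have hlt : μ ^ 2 < k ^ 2 := by nlinarith
    have hpos : 0 < 1 - μ ^ 2 / k ^ 2 := by
      rw [sub_pos, div_lt_one hk2]
      exact hlt
    have hl0 : 0 < l := hl ▸ Real.sqrt_pos.2 hpos
    have hl2 : l ^ 2 = 1 - μ ^ 2 / k ^ 2 := by rw [hl, Real.sq_sqrt hpos.le]
    have hy : 0 < 2 * k * l := by positivity
    have hS : 1 - (2 * k * l) ^ 2 / 6 ≤ Real.sin (2 * k * l) / (2 * k * l) := by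
      rw [le_div_iff₀ hy]
      linarith [Real.sin_ge_sub_cube hy.le]
    have hs0 : 0 < l ^ 2 := by positivity
    have hs1 : l ^ 2 ≤ 1 := by
      rw [hl2]
      linarith [div_nonneg (sq_nonneg μ) hk2.le]
    have hq0 : 0 ≤ (1 - l ^ 2) ^ 2 := sq_nonneg _
    have hq1 : (1 - l ^ 2) ^ 2 ≤ 1 := by nlinarith
    have hD : 4 * l ^ 2 ≤ (1 + l ^ 2) ^ 2 - Real.cos (k * l) ^ 2 * (1 - l ^ 2) ^ 2 := by
      nlinarith [mul_le_mul_of_nonneg_right (Real.cos_sq_le_one (k * l)) hq0]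
    have hk1 : 1 ≤ k ^ 2 := by nlinarith
    refine le_trans ?_ (le_max_left _ _)
    rw [div_le_iff₀ (by linarith)]
    have h1 := mul_le_mul_of_nonneg_right hS hq0
    have h2 := mul_le_mul_of_nonneg_left hD hk2.le
    have h3 : k ^ 2 * l ^ 2 * (1 - l ^ 2) ^ 2 ≤ k ^ 2 * l ^ 2 :=
      mul_le_of_le_one_right (by positivity) hq1
    have h4 : l ^ 2 ≤ k ^ 2 * l ^ 2 := le_mul_of_one_le_left hs0.le hk1
    nlinarith [sq_nonneg (l ^ 2)]
  · rintro l hkμ hl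
    have hμ1 : 3 / 2 ≤ μ := hμ0.resolve_left (hk.trans hkμ).ne'
    have hlt : k ^ 2 < μ ^ 2 := by nlinarith
    have hpos : 0 < μ ^ 2 / k ^ 2 - 1 := by
      rw [sub_pos, one_lt_div hk2]
      exact hlt
    have hl0 : 0 < l := hl ▸ Real.sqrt_pos.2 hpos
    have hl2 : l ^ 2 = μ ^ 2 / k ^ 2 - 1 := by rw [hl, Real.sq_sqrt hpos.le]
    have hy : 0 < 2 * k * l := by positivity
    have hS : Real.sinh (2 * k * l) / (2 * k * l) ≤ Real.cosh (2 * k * l) := by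
      rw [div_le_iff₀ hy]
      linarith [Real.sinh_le_mul_cosh hy.le]
    have hC := Real.one_add_sq_div_two_le_cosh hy.le
    have hkl : k ^ 2 * (l ^ 2 + 1) = μ ^ 2 := by
      rw [hl2]
      field_simp
      ring
    have hs0 : 0 < l ^ 2 := by positivity
    have hc0 : 0 ≤ (l ^ 2 + 1) ^ 2 := sq_nonneg _
    have h1 := mul_le_mul_of_nonneg_left hS hc0
    have h2 := mul_le_mul_of_nonneg_left hC hc0
    have h3 : (l ^ 2 + 1) ^ 2 * (2 * k * l) ^ 2 = 4 * μ ^ 2 * ((l ^ 2 + 1) * l ^ 2) := by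
      rw [← hkl]
      ring
    have h4 : 2 * ((l ^ 2 + 1) * l ^ 2) ≤ μ ^ 2 * ((l ^ 2 + 1) * l ^ 2) :=
      mul_le_mul_of_nonneg_right (by nlinarith) (by positivity)
    have hD : 0 < (l ^ 2 + 1) ^ 2 * (Real.cosh (2 * k * l) - 1) + 8 * l ^ 2 :=
      add_pos_of_nonneg_of_pos
        (mul_nonneg hc0 (sub_nonneg.2 (Real.one_le_cosh _))) (by positivity)
    rw [div_le_iff₀ hD]
    nlinarith [sq_nonneg (l ^ 2)]
end

section
/- Let k > 0 and let μ belong to the set M := {nπ : n ∈ ℕ₀} ∪ {(n + 1/2)π : n ∈ ℕ₀}. (i) If μ < k, then with λ := √(1 − μ²/k²), [1 − (1 − λ²)·(sin(2kλ)/(2kλ))] / [1 − (1 − λ²)·cos²(kλ)] ≤ 4·max{k², 1}. (ii) If μ > k, then with λ := √(μ²/k² − 1), 2·[(sinh(2kλ)/(2kλ))·(1 + λ²) − 1] / [(1 + λ²)·cosh(2kλ) − (1 − λ²)] ≤ 2. -/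
open scoped Real

namespace Real

theorem one_sub_sq_div_six_le_sin_div {t : ℝ} (ht : 0 < t) : 1 - t ^ 2 / 6 ≤ sin t / t := by
  rw [le_div_iff₀ ht]
  linarith [sin_ge_sub_cube ht.le]

theorem sinh_div_le_cosh {t : ℝ} (ht : 0 < t) : sinh t / t ≤ cosh t := by
  obtain ⟨c, hc, h⟩ := exists_hasDerivAt_eq_slope sinh cosh ht continuous_sinh.continuousOn
    fun x _ => hasDerivAt_sinh x
  rw [sinh_zero, sub_zero, sub_zero] at h
  rw [← h, cosh_le_cosh, abs_of_pos hc.1, abs_of_pos ht]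
  exact hc.2.le

end Real

theorem propagating_mode_le {k l : ℝ} (hk : 1 ≤ k) (hl : 0 < l) (hl1 : l ≤ 1) :
    (1 - (1 - l ^ 2) * (Real.sin (2 * k * l) / (2 * k * l)))
        / (1 - (1 - l ^ 2) * Real.cos (k * l) ^ 2)
      ≤ 4 * k ^ 2 := by
  have hS := Real.one_sub_sq_div_six_le_sin_div (t := 2 * k * l) (by positivity)
  have ha : 0 ≤ 1 - l ^ 2 := by nlinarith
  have hD : l ^ 2 ≤ 1 - (1 - l ^ 2) * Real.cos (k * l) ^ 2 := by
    nlinarith [mul_le_mul_of_nonneg_left (Real.cos_sq_le_one (k * l)) ha]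
  have hk2 : 1 ≤ k ^ 2 := one_le_pow₀ hk
  rw [div_le_iff₀ (lt_of_lt_of_le (by positivity) hD)]
  have h1 := mul_le_mul_of_nonneg_left hS ha
  have h2 := mul_le_mul_of_nonneg_left hD (by positivity : 0 ≤ 4 * k ^ 2)
  have h3 := mul_le_mul_of_nonneg_right hk2 (sq_nonneg l)
  have h4 : 0 ≤ k ^ 2 * l ^ 2 * l ^ 2 := by positivity
  have h5 : 0 ≤ k ^ 2 * l ^ 2 := by positivity
  linarith

theorem evanescent_mode_le {k l : ℝ} (hk : 0 < k) (hl : 0 < l) :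
    2 * ((Real.sinh (2 * k * l) / (2 * k * l)) * (1 + l ^ 2) - 1)
        / ((1 + l ^ 2) * Real.cosh (2 * k * l) - (1 - l ^ 2))
      ≤ 2 := by
  have hS := Real.sinh_div_le_cosh (t := 2 * k * l) (by positivity)
  have hC := Real.one_le_cosh (2 * k * l)
  have hl2 : 0 < l ^ 2 := by positivity
  have h1 := mul_le_mul_of_nonneg_left hC (by positivity : 0 ≤ 1 + l ^ 2)
  have h2 := mul_le_mul_of_nonneg_left hS (by positivity : 0 ≤ 1 + l ^ 2)
  rw [div_le_iff₀ (by linarith)]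
  linarith

/-- Per-mode bounds `φₙ ≤ 4·max{k²,1}` (propagating) and `ψₙ ≤ 2` (evanescent) for the
impedance–Dirichlet boundary configuration. -/
theorem stmt_10 (k μ : ℝ) (hk : 0 < k)
    (hμ : ∃ n : ℕ, μ = (n : ℝ) * π ∨ μ = ((n : ℝ) + 1 / 2) * π) :
    (∀ l : ℝ, μ < k → l = Real.sqrt (1 - μ ^ 2 / k ^ 2) →
      (1 - (1 - l ^ 2) * (Real.sin (2 * k * l) / (2 * k * l)))
        / (1 - (1 - l ^ 2) * Real.cos (k * l) ^ 2)
      ≤ 4 * max (k ^ 2) 1)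
    ∧ (∀ l : ℝ, k < μ → l = Real.sqrt (μ ^ 2 / k ^ 2 - 1) →
      2 * ((Real.sinh (2 * k * l) / (2 * k * l)) * (1 + l ^ 2) - 1)
        / ((1 + l ^ 2) * Real.cosh (2 * k * l) - (1 - l ^ 2))
      ≤ 2) := by
  have hμ' : μ = 0 ∨ 1 ≤ μ := by
    have hpi := Real.pi_gt_three
    obtain ⟨n, rfl | rfl⟩ := hμ
    · rcases n.eq_zero_or_pos with rfl | hn
      · simp
      · have hn' : (1 : ℝ) ≤ n := by exact_mod_cast hn
        right
        nlinarith
    · have hn' : (0 : ℝ) ≤ n := n.cast_nonneg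
      right
      nlinarith
  have hμ0 : 0 ≤ μ := by rcases hμ' with h | h <;> linarith
  refine ⟨fun l hlt hl => ?_, fun l hlt hl => ?_⟩
  · rcases hμ' with rfl | h1
    · have hl1 : l = 1 := by simp [hl]
      subst hl1
      norm_num
      linarith [le_max_right (k ^ 2) 1]
    · have hq : μ ^ 2 / k ^ 2 < 1 := by
        rw [div_lt_one (by positivity)]
        gcongr
      have hq0 : 0 ≤ μ ^ 2 / k ^ 2 := by positivity
      have hl0 : 0 < l := by
        rw [hl]
        exact Real.sqrt_pos.2 (by linarith)
      have hl1 : l ≤ 1 := by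
        rw [hl]
        exact Real.sqrt_le_one.2 (by linarith)
      refine (propagating_mode_le (by linarith) hl0 hl1).trans ?_
      gcongr
      exact le_max_left _ _
  · have hq : 1 < μ ^ 2 / k ^ 2 := by
      rw [one_lt_div (by positivity)]
      gcongr
    refine evanescent_mode_le hk ?_
    rw [hl]
    exact Real.sqrt_pos.2 (by linarith)
end

section
/- Let k > 0 and z > 0 with z ≥ π/16. (i) If z ≤ k and, for every integer j, |z − jπ| ≥ (π/8)/(1 + 2z/π), then [k² + (k² − z²)·(sin(2z)/(2z))] / [z²·sin²(z)] ≤ 1051·max{k², 1}. (ii) In all cases, [2·((k² + z²)·(sinh(2z)/(2z)) + k²)] / [z²·(cosh(2z) − 1)] ≤ 1434·max{k², 1}. -/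
open scoped Real

theorem Real.mul_cosh_le_mul_sinh {z : ℝ} (hz : 0 < z) :
    z * Real.cosh z ≤ (1 + z ^ 2 / 2) * Real.sinh z := by
  have hs : z ≤ Real.sinh z := Real.self_le_sinh_iff.2 hz.le
  have hs2 : z ^ 2 ≤ Real.sinh z ^ 2 := by gcongr
  refine le_of_sq_le_sq ?_ (by positivity [hz.trans_le hs])
  rw [mul_pow, Real.cosh_sq]
  nlinarith [mul_nonneg (sq_nonneg (z ^ 2)) (sq_nonneg (Real.sinh z))]

/-- Jordan's inequality on each half-period: `|sin z|` dominates `2 / π` times the distance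
from `z` to the nearest multiple of `π`. -/
theorem Real.exists_int_mul_abs_sub_le_abs_sin (z : ℝ) :
    ∃ j : ℤ, 2 / π * |z - j * π| ≤ |Real.sin z| := by
  refine ⟨round (z / π), ?_⟩
  have hround : |z - round (z / π) * π| ≤ π / 2 := by
    have h := abs_sub_round (z / π)
    have heq : z - round (z / π) * π = (z / π - round (z / π)) * π := by
      field_simp
    rw [heq, abs_mul, abs_of_pos Real.pi_pos]
    nlinarith [Real.pi_pos]
  have hsin : |Real.sin (z - round (z / π) * π)| = |Real.sin z| := by
    rw [Real.sin_sub_int_mul_pi, abs_mul, abs_zpow]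
    simp
  rw [← hsin]
  exact Real.mul_abs_le_abs_sin hround

/-- A point at distance at least `(π / 8) / (1 + 2 z / π)` from `π ℤ` keeps `z sin z` away
from zero. -/
theorem Real.pi_div_le_mul_abs_sin {z : ℝ} (hz16 : π / 16 ≤ z)
    (h : ∀ j : ℤ, (π / 8) / (1 + 2 * z / π) ≤ |z - j * π|) :
    π / 72 ≤ z * |Real.sin z| := by
  have hπ := Real.pi_pos
  have hz : 0 < z := by linarith
  obtain ⟨j, hj⟩ := Real.exists_int_mul_abs_sub_le_abs_sin z
  calc π / 72 ≤ z * (2 / π * ((π / 8) / (1 + 2 * z / π))) := by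
        have heq : z * (2 / π * ((π / 8) / (1 + 2 * z / π))) = z * π / (4 * (π + 2 * z)) := by
          field_simp
          ring
        rw [heq, div_le_div_iff₀ (by norm_num) (by positivity)]
        nlinarith
    _ ≤ z * |Real.sin z| := by
        gcongr
        exact le_trans (by gcongr; exact h j) hj

theorem propagating_mode_bound {k z : ℝ} (hz16 : π / 16 ≤ z) (hzk : z ≤ k)
    (h : ∀ j : ℤ, (π / 8) / (1 + 2 * z / π) ≤ |z - j * π|) :
    (k ^ 2 + (k ^ 2 - z ^ 2) * (Real.sin (2 * z) / (2 * z))) / (z ^ 2 * Real.sin z ^ 2)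
      ≤ 1051 * max (k ^ 2) 1 := by
  have hπ := Real.pi_gt_d4
  have hz : 0 < z := by linarith
  have hlow := Real.pi_div_le_mul_abs_sin hz16 h
  have hden : (π / 72) ^ 2 ≤ z ^ 2 * Real.sin z ^ 2 := by
    rw [← sq_abs (Real.sin z), ← mul_pow]
    gcongr
  have hsinc : Real.sin (2 * z) / (2 * z) ≤ 1 :=
    div_le_one_of_le₀ (Real.sin_le (by linarith)) (by linarith)
  have hkz : 0 ≤ k ^ 2 - z ^ 2 := by nlinarith
  have hnum : k ^ 2 + (k ^ 2 - z ^ 2) * (Real.sin (2 * z) / (2 * z)) ≤ 2 * k ^ 2 := by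
    nlinarith [mul_le_mul_of_nonneg_left hsinc hkz]
  have hpi : 2 ≤ 1051 * (π / 72) ^ 2 := by nlinarith
  rw [div_le_iff₀ (lt_of_lt_of_le (by positivity) hden)]
  calc _ ≤ 2 * k ^ 2 := hnum
    _ ≤ (1051 * (z ^ 2 * Real.sin z ^ 2)) * max (k ^ 2) 1 := by
        gcongr
        · linarith
        · exact le_max_left _ _
    _ = _ := by ring

theorem evanescent_mode_bound {z : ℝ} (k : ℝ) (hz16 : π / 16 ≤ z) :
    2 * ((k ^ 2 + z ^ 2) * (Real.sinh (2 * z) / (2 * z)) + k ^ 2)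
        / (z ^ 2 * (Real.cosh (2 * z) - 1))
      ≤ 1434 * max (k ^ 2) 1 := by
  have hπ := Real.pi_gt_d4
  have hz : 0 < z := by linarith
  have hu : 0.0385 ≤ z ^ 2 := by nlinarith
  have hS : 0 < Real.sinh z := Real.sinh_pos_iff.2 hz
  have hzS : z ^ 2 ≤ Real.sinh z ^ 2 := by
    gcongr
    exact Real.self_le_sinh_iff.2 hz.le
  have hcosh := Real.mul_cosh_le_mul_sinh hz
  have hcosh2 : Real.cosh (2 * z) - 1 = 2 * Real.sinh z ^ 2 := by
    rw [Real.cosh_two_mul, Real.cosh_sq]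
    ring
  rw [hcosh2, Real.sinh_two_mul, div_le_iff₀ (by positivity)]
  set S := Real.sinh z
  set C := Real.cosh z
  set M := max (k ^ 2) 1
  have hM1 : 1 ≤ M := le_max_right _ _
  have hMk : k ^ 2 ≤ M := le_max_left _ _
  have hsum : k ^ 2 + z ^ 2 ≤ M * (1 + z ^ 2) := by nlinarith [sq_nonneg z]
  have hquot : 2 * S * C / (2 * z) ≤ (1 + z ^ 2 / 2) * S ^ 2 / z ^ 2 := by
    rw [div_le_div_iff₀ (by positivity) (by positivity)]
    nlinarith [mul_le_mul_of_nonneg_left hcosh (by positivity : 0 ≤ 2 * z * S)]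
  have hk : k ^ 2 ≤ M * (S ^ 2 / z ^ 2) := by
    have h1 : 1 ≤ S ^ 2 / z ^ 2 := (one_le_div (by positivity)).2 hzS
    nlinarith
  have hpoly : ((1 + z ^ 2) * (1 + z ^ 2 / 2) + 1) / z ^ 2 ≤ 1434 * z ^ 2 := by
    rw [div_le_iff₀ (by positivity)]
    nlinarith
  calc 2 * ((k ^ 2 + z ^ 2) * (2 * S * C / (2 * z)) + k ^ 2)
      ≤ 2 * (M * (1 + z ^ 2) * ((1 + z ^ 2 / 2) * S ^ 2 / z ^ 2) + M * (S ^ 2 / z ^ 2)) := by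
        have hC : 0 < C := Real.cosh_pos z
        gcongr
    _ = 2 * M * S ^ 2 * (((1 + z ^ 2) * (1 + z ^ 2 / 2) + 1) / z ^ 2) := by ring
    _ ≤ 2 * M * S ^ 2 * (1434 * z ^ 2) := by gcongr
    _ = 1434 * M * (z ^ 2 * (2 * S ^ 2)) := by ring

/-- Per-mode bounds `φ̃ₙ ≤ 1051·max{k²,1}` (propagating) and `ψ̃ₙ ≤ 1434·max{k²,1}`
(evanescent) for the lifting with Neumann datum on the bottom side and homogeneous
Neumann condition on the top side. -/
theorem stmt_13 (k z : ℝ) (hk : 0 < k) (hz : 0 < z) (hz16 : z ≥ π / 16) :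
    ((z ≤ k ∧ ∀ j : ℤ, |z - (j : ℝ) * π| ≥ (π / 8) / (1 + 2 * z / π)) →
      (k ^ 2 + (k ^ 2 - z ^ 2) * (Real.sin (2 * z) / (2 * z)))
        / (z ^ 2 * Real.sin z ^ 2)
      ≤ 1051 * max (k ^ 2) 1)
    ∧ (2 * ((k ^ 2 + z ^ 2) * (Real.sinh (2 * z) / (2 * z)) + k ^ 2)
        / (z ^ 2 * (Real.cosh (2 * z) - 1))
      ≤ 1434 * max (k ^ 2) 1) := by
  exact ⟨fun h => propagating_mode_bound hz16 h.1 h.2, evanescent_mode_bound k hz16⟩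
end

section
/- Let n be a positive integer and set k := √(n²π² + π²). Define u : [0,1]² → ℝ by u(x,y) = −(1/π)·sin(πx)·√2·sin(nπy). Then: (i) Δu(x,y) + k²·u(x,y) = 0 for all (x,y) ∈ (0,1)²; (ii) u(x,0) = u(x,1) = 0 for all x ∈ [0,1]; (iii) u(1,y) = 0 for all y ∈ [0,1]; (iv) −∂ₓu(0,y) − i·k·u(0,y) = √2·sin(nπy) for all y ∈ [0,1]; and (v) ‖∇u‖_{0,Ω} + k·‖u‖_{0,Ω} = (√2/π)·k, where Ω = (0,1)², ‖v‖_{0,Ω} := (∫_Ω |v|²)^{1/2} and ‖∇u‖_{0,Ω} := (∫_Ω |∂ₓu|² + |∂_y u|²)^{1/2}. -/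
open scoped Real

theorem integral_sin_sq_nat_mul_pi {n : ℕ} (hn : 0 < n) :
    ∫ x in (0 : ℝ)..1, Real.sin ((n : ℝ) * π * x) ^ 2 = 1 / 2 := by
  have h : (n : ℝ) * π ≠ 0 := by positivity
  rw [intervalIntegral.integral_comp_mul_left (fun t => Real.sin t ^ 2) h, integral_sin_sq]
  simp only [mul_zero, mul_one, Real.sin_zero, Real.sin_nat_mul_pi, smul_eq_mul]
  field_simp
  ring

theorem integral_cos_sq_nat_mul_pi {n : ℕ} (hn : 0 < n) :
    ∫ x in (0 : ℝ)..1, Real.cos ((n : ℝ) * π * x) ^ 2 = 1 / 2 := by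
  have h : (n : ℝ) * π ≠ 0 := by positivity
  rw [intervalIntegral.integral_comp_mul_left (fun t => Real.cos t ^ 2) h, integral_cos_sq]
  simp only [mul_zero, mul_one, Real.sin_zero, Real.sin_nat_mul_pi, smul_eq_mul]
  field_simp
  ring

theorem deriv_const_mul_sin_mul (c a : ℝ) :
    (deriv fun x => c * Real.sin (a * x)) = fun x => c * a * Real.cos (a * x) := by
  ext x
  have h := (((hasDerivAt_id x).const_mul a).sin).const_mul c
  simp only [id_eq, mul_one] at h
  rw [h.deriv]
  ring

theorem deriv_const_mul_cos_mul (c a : ℝ) :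
    (deriv fun x => c * Real.cos (a * x)) = fun x => -(c * a) * Real.sin (a * x) := by
  ext x
  have h := (((hasDerivAt_id x).const_mul a).cos).const_mul c
  simp only [id_eq, mul_one] at h
  rw [h.deriv]
  ring

/-- Sharpness example for the impedance–Dirichlet stability bound: the explicit
solution `u(x,y) = −(1/π)·sin(πx)·√2·sin(nπy)` with `k = √(n²π² + π²)`. -/
theorem stmt_16 (n : ℕ) (hn : 0 < n) (k : ℝ)
    (hk : k = Real.sqrt ((n : ℝ) ^ 2 * π ^ 2 + π ^ 2))
    (u : ℝ → ℝ → ℝ)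
    (hu : ∀ x y : ℝ,
      u x y = -(1 / π) * Real.sin (π * x) * (Real.sqrt 2 * Real.sin ((n : ℝ) * π * y))) :
    (∀ x ∈ Set.Ioo (0 : ℝ) 1, ∀ y ∈ Set.Ioo (0 : ℝ) 1,
      deriv (deriv fun s => u s y) x + deriv (deriv fun t => u x t) y
        + k ^ 2 * u x y = 0)
    ∧ (∀ x ∈ Set.Icc (0 : ℝ) 1, u x 0 = 0 ∧ u x 1 = 0)
    ∧ (∀ y ∈ Set.Icc (0 : ℝ) 1, u 1 y = 0)
    ∧ (∀ y ∈ Set.Icc (0 : ℝ) 1,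
        -((deriv (fun s => u s y) 0 : ℝ) : ℂ) - Complex.I * (k : ℂ) * ((u 0 y : ℝ) : ℂ)
          = ((Real.sqrt 2 * Real.sin ((n : ℝ) * π * y) : ℝ) : ℂ))
    ∧ (Real.sqrt (∫ x in (0 : ℝ)..1, ∫ y in (0 : ℝ)..1,
          (deriv (fun s => u s y) x) ^ 2 + (deriv (fun t => u x t) y) ^ 2)
        + k * Real.sqrt (∫ x in (0 : ℝ)..1, ∫ y in (0 : ℝ)..1, (u x y) ^ 2)
        = (Real.sqrt 2 / π) * k) := by
  have hk2 : k ^ 2 = (n : ℝ) ^ 2 * π ^ 2 + π ^ 2 := by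
    rw [hk, Real.sq_sqrt (by positivity)]
  have hk0 : 0 ≤ k := hk ▸ Real.sqrt_nonneg _
  have h2 : Real.sqrt 2 ^ 2 = 2 := Real.sq_sqrt (by norm_num)
  have hux (y : ℝ) : (fun s => u s y) =
      fun s => (-(1 / π) * (Real.sqrt 2 * Real.sin ((n : ℝ) * π * y))) * Real.sin (π * s) := by
    ext s
    rw [hu]
    ring
  have huy (x : ℝ) : (fun t => u x t) =
      fun t => (-(1 / π) * Real.sin (π * x) * Real.sqrt 2) * Real.sin ((n : ℝ) * π * t) := by
    ext t
    rw [hu]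
    ring
  have hsin : ∫ x in (0 : ℝ)..1, Real.sin (π * x) ^ 2 = 1 / 2 := by
    simpa using integral_sin_sq_nat_mul_pi one_pos
  have hcos : ∫ x in (0 : ℝ)..1, Real.cos (π * x) ^ 2 = 1 / 2 := by
    simpa using integral_cos_sq_nat_mul_pi one_pos
  have hgrad : ∫ x in (0 : ℝ)..1, ∫ y in (0 : ℝ)..1,
      ((deriv (fun s => u s y) x) ^ 2 + (deriv (fun t => u x t) y) ^ 2)
      = (k / (Real.sqrt 2 * π)) ^ 2 := by
    have hinner (x : ℝ) : ∫ y in (0 : ℝ)..1,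
        ((deriv (fun s => u s y) x) ^ 2 + (deriv (fun t => u x t) y) ^ 2)
        = Real.cos (π * x) ^ 2 + (n : ℝ) ^ 2 * Real.sin (π * x) ^ 2 := by
      have hsq (y : ℝ) : (deriv (fun s => u s y) x) ^ 2 + (deriv (fun t => u x t) y) ^ 2
          = 2 * Real.cos (π * x) ^ 2 * Real.sin ((n : ℝ) * π * y) ^ 2
            + 2 * (n : ℝ) ^ 2 * Real.sin (π * x) ^ 2 * Real.cos ((n : ℝ) * π * y) ^ 2 := by
        rw [hux, huy, deriv_const_mul_sin_mul, deriv_const_mul_sin_mul]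
        field_simp
        rw [h2]
        ring
      simp only [hsq]
      rw [intervalIntegral.integral_add
          (Continuous.intervalIntegrable (by fun_prop) _ _)
          (Continuous.intervalIntegrable (by fun_prop) _ _),
        intervalIntegral.integral_const_mul, intervalIntegral.integral_const_mul,
        integral_sin_sq_nat_mul_pi hn, integral_cos_sq_nat_mul_pi hn]
      ring
    simp only [hinner]
    rw [intervalIntegral.integral_add
        (Continuous.intervalIntegrable (by fun_prop) _ _)
        (Continuous.intervalIntegrable (by fun_prop) _ _),
      intervalIntegral.integral_const_mul, hsin, hcos, div_pow, mul_pow, h2, hk2]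
    field_simp
    ring
  have hL2 : ∫ x in (0 : ℝ)..1, ∫ y in (0 : ℝ)..1, (u x y) ^ 2
      = (1 / (Real.sqrt 2 * π)) ^ 2 := by
    have hsq (x y : ℝ) : (u x y) ^ 2
        = 2 / π ^ 2 * Real.sin (π * x) ^ 2 * Real.sin ((n : ℝ) * π * y) ^ 2 := by
      rw [hu]
      field_simp
      rw [h2]
      ring
    simp only [hsq, intervalIntegral.integral_const_mul, intervalIntegral.integral_mul_const,
      integral_sin_sq_nat_mul_pi hn, hsin]
    rw [div_pow, mul_pow, h2]
    field_simp
  refine ⟨fun x _ y _ => ?_, fun x _ => ?_, fun y _ => ?_, fun y _ => ?_, ?_⟩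
  · rw [hux, huy]
    simp only [deriv_const_mul_sin_mul, deriv_const_mul_cos_mul]
    rw [hk2, hu]
    ring
  · simp [hu, Real.sin_nat_mul_pi]
  · simp [hu]
  · have hu0 : u 0 y = 0 := by simp [hu]
    rw [hux, deriv_const_mul_sin_mul, hu0, Complex.ofReal_zero, mul_zero, sub_zero,
      ← Complex.ofReal_neg]
    congr 1
    simp only [mul_zero, Real.cos_zero]
    field_simp
  · rw [hgrad, hL2, Real.sqrt_sq (by positivity), Real.sqrt_sq (by positivity)]
    field_simp
    rw [h2]
    ring
end
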